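/- arXiv:2312.08911 — 4 statements merged into one kernel-verified Lean document; each statement's English description precedes it below -/
import Mathlib

section
/- For every n : ℕ, the recurring domino problem on the free group FreeGroup (Fin n), with respect to the free generating family σ i = FreeGroup.of i, is decidable: the predicate on triples ⟨m, F, a₀⟩, where m : ℕ, F : Finset (Fin m × Fin m × Fin n) and a₀ : Fin m, asserting that there exists x : FreeGroup (Fin n) → Fin m with (x g, x (g * FreeGroup.of i), i) ∉ F for all g and i, and with {g | x g = a₀} infinite, is ComputablePred with respect to a natural Primcodable encoding of such triples. -/
/-- An instance of the recurring domino problem on the free group on `n`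
generators: an alphabet size `m`, a finite set of forbidden nearest-neighbour
patterns, and a target letter `a₀ : Fin m`. -/
abbrev DomInstance (k : ℕ) : Type := Σ m : ℕ, Finset (Fin m × Fin m × Fin k) × Fin m

instance (k : ℕ) : Infinite (DomInstance k) :=
  Infinite.of_injective (fun n => (⟨n + 1, ∅, 0⟩ : DomInstance k)) fun a b h => by
    have : a + 1 = b + 1 := congrArg Sigma.fst h
    omega

noncomputable instance (k : ℕ) : Denumerable (DomInstance k) :=
  Denumerable.ofEncodableOfInfinite _

open Encodable

theorem encode_list_map_encode {α : Type*} [Encodable α] (l : List α) :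
    encode (l.map encode) = encode l := by
  induction l <;> simp [*]

theorem encode_finset_eq_encode_sort {α : Type*} [Encodable α] (F : Finset α) :
    encode F = encode ((F.1.map (encode : α → ℕ)).sort (· ≤ ·)) := by
  let : IsLinearOrder α ((encode : α → ℕ) ⁻¹'o (· ≤ ·)) :=
    (RelEmbedding.preimage ⟨_, encode_injective⟩ (· ≤ ·)).isLinearOrder
  let : DecidableRel ((encode : α → ℕ) ⁻¹'o (· ≤ ·)) :=
    fun a b => inferInstanceAs (Decidable (encode a ≤ encode b))
  have : encode F = encode (F.1.sort ((encode : α → ℕ) ⁻¹'o (· ≤ ·))) := rfl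
  rw [this, ← encode_list_map_encode, Multiset.map_sort encode F.1 _ (· ≤ ·)]
  intros; rfl

theorem encode_ofEncodableOfInfinite {α : Type*} [h : Encodable α] [Infinite α] (a : α)
    [DecidablePred fun x => x ∈ Set.range h.encode] :
    (Denumerable.ofEncodableOfInfinite α).toEncodable.encode a =
      Nat.count (fun x => x ∈ Set.range h.encode) (h.encode a) := by
  have : (Denumerable.ofEncodableOfInfinite α).toEncodable.encode a =
      (List.range (h.encode a)).countP
        (fun x => @decide (x ∈ Set.range h.encode) (decidableRangeEncode α x)) := rfl
  rw [this, Nat.count_eq_card_filter_range, List.countP_eq_length_filter]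
  simp only [Finset.card, Finset.filter, Multiset.range, Finset.range, Multiset.filter_coe,
    Multiset.coe_card]
  congr!

theorem primrec_sublists' {α : Type*} [Primcodable α] :
    Primrec (List.sublists' : List α → List (List α)) := by
  have : Primrec fun l : List α =>
      l.foldr (fun a r => r ++ r.map (List.cons a)) [[]] := by
    refine Primrec.list_foldr (f := fun l : List α => l)
      (h := fun _ (p : α × List (List α)) => p.2 ++ p.2.map (List.cons p.1))
      Primrec.id (Primrec.const [[]]) ?_
    have hr : Primrec fun p : List α × α × List (List α) => p.2.2 :=
      Primrec.snd.comp Primrec.snd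
    exact Primrec.list_append.comp hr (Primrec.list_map hr
      ((Primrec.list_cons (α := α)).comp
        (Primrec.fst.comp (Primrec.snd.comp Primrec.fst)) Primrec.snd))
  refine this.of_eq fun l => ?_
  induction l with
  | nil => rfl
  | cons a l ih => rw [List.foldr_cons, ih, List.sublists'_cons]

section BoundedQuantifiers

variable {α β : Type*} [Primcodable α] [Primcodable β]

theorem PrimrecPred.forall_mem {l : α → List β} {p : α → β → Prop} (hl : Primrec l)
    (hp : PrimrecPred fun x : α × β => p x.1 x.2) : PrimrecPred fun a => ∀ b ∈ l a, p a b := by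
  have : PrimrecRel fun (b : β) (a : α) => p a b :=
    hp.comp (Primrec.pair Primrec.snd Primrec.fst)
  exact this.forall_mem_list.comp hl Primrec.id

theorem PrimrecPred.exists_mem {l : α → List β} {p : α → β → Prop} (hl : Primrec l)
    (hp : PrimrecPred fun x : α × β => p x.1 x.2) : PrimrecPred fun a => ∃ b ∈ l a, p a b := by
  have : PrimrecRel fun (b : β) (a : α) => p a b :=
    hp.comp (Primrec.pair Primrec.snd Primrec.fst)
  exact this.exists_mem_list.comp hl Primrec.id

theorem PrimrecPred.mem_list {f : α → β} {l : α → List β} (hf : Primrec f) (hl : Primrec l) :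
    PrimrecPred fun a => f a ∈ l a := by
  classical
  refine (PrimrecPred.exists_mem (p := fun a b => b = f a) hl
    (Primrec.eq.comp Primrec.snd (hf.comp Primrec.fst))).of_eq fun a => ?_
  simp

theorem PrimrecPred.imp {p q : α → Prop} (hp : PrimrecPred p) (hq : PrimrecPred q) :
    PrimrecPred fun a => p a → q a :=
  (hp.not.or hq).of_eq fun _ => imp_iff_not_or.symm

end BoundedQuantifiers

/-- The code of a domino instance given by the underlying `Sigma` encoding. -/
def sigmaCode {n : ℕ} (I : DomInstance n) : ℕ :=
  Sigma.encodable.encode I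

theorem sigmaCode_mk {n m : ℕ} (F : Finset (Fin m × Fin m × Fin n)) (a : Fin m) :
    sigmaCode ⟨m, F, a⟩ = Nat.pair m (Nat.pair (encode F) a) := rfl

/-- The sorted list of codes of the forbidden patterns. -/
def codeList {m n : ℕ} (F : Finset (Fin m × Fin m × Fin n)) : List ℕ :=
  (F.1.map (encode : _ → ℕ)).sort (· ≤ ·)

theorem encode_pattern {m n : ℕ} (t : Fin m × Fin m × Fin n) :
    encode t = Nat.pair t.1 (Nat.pair t.2.1 t.2.2) := rfl

theorem mem_codeList {m n : ℕ} {F : Finset (Fin m × Fin m × Fin n)} {e : ℕ} :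
    e ∈ codeList F ↔ ∃ t ∈ F, encode t = e := by
  simp only [codeList, Multiset.mem_sort, Multiset.mem_map, Finset.mem_val]

theorem encode_mem_codeList {m n : ℕ} {F : Finset (Fin m × Fin m × Fin n)}
    {t : Fin m × Fin m × Fin n} : encode t ∈ codeList F ↔ t ∈ F := by
  rw [mem_codeList]
  exact ⟨fun ⟨u, hu, h⟩ => encode_injective h ▸ hu, fun h => ⟨t, h, rfl⟩⟩

theorem sortedLT_codeList {m n : ℕ} (F : Finset (Fin m × Fin m × Fin n)) :
    (codeList F).SortedLT := by
  have hs : (codeList F).SortedLE := (Multiset.pairwise_sort _ _).sortedLE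
  refine hs.sortedLT_of_nodup ?_
  rw [← Multiset.coe_nodup, codeList, Multiset.sort_eq]
  exact F.2.map encode_injective

theorem exists_codeList_eq {m n : ℕ} {L : List ℕ} (hL : L.SortedLT)
    (h : ∀ e ∈ L, e.unpair.1 < m ∧ e.unpair.2.unpair.1 < m ∧ e.unpair.2.unpair.2 < n) :
    ∃ F : Finset (Fin m × Fin m × Fin n), codeList F = L := by
  classical
  refine ⟨Finset.univ.filter fun t => encode t ∈ L, ?_⟩
  refine (sortedLT_codeList _).eq_of_mem_iff hL fun e => ?_
  rw [mem_codeList]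
  constructor
  · rintro ⟨t, ht, rfl⟩
    simpa using ht
  · intro he
    obtain ⟨h1, h2, h3⟩ := h e he
    have : encode ((⟨_, h1⟩, ⟨_, h2⟩, ⟨_, h3⟩) : Fin m × Fin m × Fin n) = e := by
      rw [encode_pattern]
      change Nat.pair e.unpair.1 (Nat.pair e.unpair.2.unpair.1 e.unpair.2.unpair.2) = e
      rw [Nat.pair_unpair, Nat.pair_unpair]
    exact ⟨_, by simp only [Finset.mem_filter, Finset.mem_univ, true_and, this, he], this⟩

/-- The numbers that code a domino instance. -/
def IsCode (n j : ℕ) : Prop :=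
  j.unpair.2.unpair.2 < j.unpair.1 ∧
  Denumerable.ofNat (List ℕ) j.unpair.2.unpair.1 ∈
    (List.range (Nat.pair j.unpair.1 (Nat.pair j.unpair.1 n))).sublists' ∧
  ∀ e ∈ Denumerable.ofNat (List ℕ) j.unpair.2.unpair.1,
    e.unpair.1 < j.unpair.1 ∧ e.unpair.2.unpair.1 < j.unpair.1 ∧ e.unpair.2.unpair.2 < n

theorem sublist_range_iff {L : List ℕ} {N : ℕ} :
    L.Sublist (List.range N) ↔ L.SortedLT ∧ ∀ e ∈ L, e < N := by
  constructor
  · intro h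
    exact ⟨(List.Pairwise.sublist h List.pairwise_lt_range).sortedLT,
      fun e he => List.mem_range.1 (h.subset he)⟩
  · rintro ⟨h1, h2⟩
    refine List.sublist_of_subperm_of_sortedLE
      (List.subperm_of_subset h1.nodup fun e he => List.mem_range.2 (h2 e he))
      h1.sortedLE List.pairwise_le_range.sortedLE

theorem mem_range_sigmaCode {n j : ℕ} :
    j ∈ Set.range (sigmaCode : DomInstance n → ℕ) ↔ IsCode n j := by
  constructor
  · rintro ⟨⟨m, F, a⟩, rfl⟩
    have he : ∀ e ∈ codeList F,
        e.unpair.1 < m ∧ e.unpair.2.unpair.1 < m ∧ e.unpair.2.unpair.2 < n := by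
      intro e he
      obtain ⟨t, -, rfl⟩ := mem_codeList.1 he
      simp [encode_pattern]
    rw [sigmaCode_mk, encode_finset_eq_encode_sort]
    simp only [IsCode, Nat.unpair_pair, Denumerable.ofNat_encode, List.mem_sublists',
      sublist_range_iff]
    refine ⟨a.2, ⟨sortedLT_codeList F, fun e h => ?_⟩, he⟩
    obtain ⟨h1, h2, h3⟩ := he e h
    rw [← Nat.pair_unpair e, ← Nat.pair_unpair e.unpair.2]
    exact (Nat.pair_lt_pair_left _ h1).trans
      (Nat.pair_lt_pair_right _ ((Nat.pair_lt_pair_left _ h2).trans (Nat.pair_lt_pair_right _ h3)))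
  · rintro ⟨h1, h2, h3⟩
    rw [List.mem_sublists', sublist_range_iff] at h2
    obtain ⟨F, hF⟩ := exists_codeList_eq h2.1 h3
    refine ⟨⟨j.unpair.1, F, ⟨_, h1⟩⟩, ?_⟩
    rw [sigmaCode_mk, encode_finset_eq_encode_sort]
    change Nat.pair _ (Nat.pair (encode (codeList F)) _) = _
    rw [hF, Denumerable.encode_ofNat, Nat.pair_unpair, Nat.pair_unpair]

theorem primrecPred_isCode (n : ℕ) : PrimrecPred (IsCode n) := by
  have h1 : Primrec fun j : ℕ => j.unpair.1 := Primrec.fst.comp Primrec.unpair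
  have h2 : Primrec fun j : ℕ => j.unpair.2 := Primrec.snd.comp Primrec.unpair
  have hL : Primrec fun j : ℕ => Denumerable.ofNat (List ℕ) j.unpair.2.unpair.1 :=
    (Primrec.ofNat _).comp (h1.comp h2)
  refine .and (Primrec.nat_lt.comp (h2.comp h2) h1) (.and (.mem_list hL ?_) (.forall_mem hL ?_))
  · exact primrec_sublists'.comp (Primrec.list_range.comp
      (Primrec₂.natPair.comp h1 (Primrec₂.natPair.comp h1 (Primrec.const n))))
  · have hm := h1.comp (Primrec.fst (α := ℕ) (β := ℕ))
    have he := Primrec.snd (α := ℕ) (β := ℕ)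
    exact .and (Primrec.nat_lt.comp (h1.comp he) hm)
      (.and (Primrec.nat_lt.comp (h1.comp (h2.comp he)) hm)
        (Primrec.nat_lt.comp (h2.comp (h2.comp he)) (Primrec.const n)))

theorem computable_sigmaCode (n : ℕ) : Computable (sigmaCode : DomInstance n → ℕ) := by
  classical
  have hcount : Primrec fun j => Nat.count (IsCode n) j := by
    refine (Primrec.list_length.comp ((Primrec.listFilter (primrecPred_isCode n)).comp
      Primrec.list_range)).of_eq fun j => ?_
    rw [Nat.count_eq_card_filter_range]
    rfl
  have henc (I : DomInstance n) :
      (Denumerable.toEncodable : Encodable (DomInstance n)).encode I =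
        Nat.count (IsCode n) (sigmaCode I) := by
    refine (encode_ofEncodableOfInfinite (h := Sigma.encodable) I).trans ?_
    congr! 1
    exact funext fun x => propext mem_range_sigmaCode
  have hp : PrimrecPred fun x : DomInstance n × ℕ =>
      IsCode n x.2 ∧ Nat.count (IsCode n) x.2 =
        (Denumerable.toEncodable : Encodable (DomInstance n)).encode x.1 :=
    ((primrecPred_isCode n).comp Primrec.snd).and
      (Primrec.eq.comp (hcount.comp Primrec.snd) (Primrec.encode.comp Primrec.fst))
  have hr := Partrec.rfind (Computable.partrec hp.decide.to_comp).to₂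
  refine Partrec.of_eq hr fun I => ?_
  have hI : IsCode n (sigmaCode I) := mem_range_sigmaCode.1 ⟨I, rfl⟩
  refine Part.eq_some_iff.2 (Nat.mem_rfind.2 ⟨?_, fun {k} hk => ?_⟩)
  · simp [hI, henc]
  · simp only [henc]
    refine Part.mem_some_iff.2 (decide_eq_false ?_).symm
    rintro ⟨h1, h2⟩
    exact hk.ne (Nat.count_injective h1 hI h2)

/-- The data of a domino instance: the size of the alphabet, the list of codes of forbidden patterns
and the target letter. -/
def rawData {n : ℕ} (I : DomInstance n) : ℕ × List ℕ × ℕ :=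
  (I.1, codeList I.2.1, I.2.2)

theorem computable_rawData (n : ℕ) : Computable (rawData : DomInstance n → _) := by
  have h1 : Primrec fun j : ℕ => j.unpair.1 := Primrec.fst.comp Primrec.unpair
  have h2 : Primrec fun j : ℕ => j.unpair.2 := Primrec.snd.comp Primrec.unpair
  have h : Primrec fun j : ℕ =>
      (j.unpair.1, Denumerable.ofNat (List ℕ) j.unpair.2.unpair.1, j.unpair.2.unpair.2) :=
    h1.pair (((Primrec.ofNat _).comp (h1.comp h2)).pair (h2.comp h2))
  refine (h.to_comp.comp (computable_sigmaCode n)).of_eq fun ⟨m, F, a⟩ => ?_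
  simp only [sigmaCode_mk, encode_finset_eq_encode_sort, Nat.unpair_pair,
    Denumerable.ofNat_encode]
  rfl

namespace FreeGroupDomino

variable {α β : Type*}

/-- The constraint imposed on the labels of a group element and its neighbour in direction `s`. -/
def LetterRel (R : β → α → α → Prop) (s : β × Bool) (a b : α) : Prop :=
  if s.2 then R s.1 a b else R s.1 b a

/-- One step of a labelled reduced walk. A node records a label and the letter by which the walk
arrived at it. -/
def NodeStep (R : β → α → α → Prop) (V : Set α) (u v : α × (β × Bool)) : Prop :=
  u.1 ∈ V ∧ v.1 ∈ V ∧ LetterRel R v.2 u.1 v.1 ∧ (u.2.1 = v.2.1 → u.2.2 = v.2.2)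

/-- There is a closed labelled reduced walk from one of whose nodes a walk to the label `a₀`
branches off. -/
def HasRecurringLoop (R : β → α → α → Prop) (V : Set α) (a₀ : α) : Prop :=
  ∃ u v, NodeStep R V u v ∧ Relation.ReflTransGen (NodeStep R V) v u ∧
    (u.1 = a₀ ∨ ∃ v' w, NodeStep R V u v' ∧ v'.2 ≠ v.2 ∧
      Relation.ReflTransGen (NodeStep R V) v' w ∧ w.1 = a₀)

/-- Labels from `V` can be extended in every direction. -/
def IsExtendable (R : β → α → α → Prop) (V : Set α) : Prop :=
  ∀ a ∈ V, ∀ s, ∃ b ∈ V, LetterRel R s a b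

/-- A labelling by `V` of all words, reduced or not, respecting the constraints. -/
def IsTree (R : β → α → α → Prop) (V : Set α) (y : List (β × Bool) → α) : Prop :=
  (∀ l, y l ∈ V) ∧ ∀ l s, LetterRel R s (y l) (y (l ++ [s]))

/-- The labelling of words with label `a` at the root and the labellings `f s` below it. -/
def graft (a : α) (f : β × Bool → List (β × Bool) → α) : List (β × Bool) → α
  | [] => a
  | s :: l => f s l

theorem isReduced_of_append_append {L w : List (β × Bool)} (h : FreeGroup.IsReduced L)
    (u v : List (β × Bool)) (e : u ++ w ++ v = L) : FreeGroup.IsReduced w := by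
  subst e
  exact (List.IsChain.left_of_append h).right_of_append

variable {R : β → α → α → Prop} {V : Set α} {a₀ : α}

theorem IsTree.graft {a : α} {f : β × Bool → List (β × Bool) → α} (ha : a ∈ V)
    (hf : ∀ s, IsTree R V (f s)) (haf : ∀ s, LetterRel R s a (f s [])) :
    IsTree R V (graft a f) := by
  constructor
  · rintro (_ | ⟨s, l⟩)
    exacts [ha, (hf s).1 l]
  · rintro (_ | ⟨t, l⟩) s
    exacts [haf s, (hf t).2 l s]

theorem IsExtendable.exists_isTree (hV : IsExtendable R V) {a : α} (ha : a ∈ V) :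
    ∃ y, IsTree R V y ∧ y [] = a := by
  choose nxt hmem hrel using hV
  let step : V → β × Bool → V := fun b s => ⟨nxt b b.2 s, hmem b b.2 s⟩
  refine ⟨fun l => (l.foldl step ⟨a, ha⟩ : V), ⟨fun l => Subtype.prop _, fun l s => ?_⟩, rfl⟩
  simp only [List.foldl_append]
  exact hrel _ _ s

theorem IsExtendable.exists_isTree_letterRel (hV : IsExtendable R V) {a : α} (ha : a ∈ V)
    (s : β × Bool) : ∃ y, IsTree R V y ∧ LetterRel R s a (y []) := by
  obtain ⟨b, hb, hab⟩ := hV a ha s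
  obtain ⟨y, hy, rfl⟩ := hV.exists_isTree hb
  exact ⟨y, hy, hab⟩

theorem IsExtendable.exists_isTree_of_reflTransGen (hV : IsExtendable R V) {v w : α × (β × Bool)}
    (h : Relation.ReflTransGen (NodeStep R V) v w) (hv : v.1 ∈ V) (hw : w.1 = a₀) :
    ∃ y, IsTree R V y ∧ y [] = v.1 ∧ ∃ z, FreeGroup.IsReduced (v.2 :: z) ∧ y z = a₀ := by
  classical
  induction h using Relation.ReflTransGen.head_induction_on with
  | refl =>
    obtain ⟨y, hy, hy'⟩ := hV.exists_isTree hv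
    exact ⟨y, hy, hy', [], FreeGroup.IsReduced.singleton, hy'.trans hw⟩
  | @head u v huv _ ih =>
    obtain ⟨y, hy, hyv, z, hz, hyz⟩ := ih huv.2.1
    choose d hd hd' using fun s => hV.exists_isTree_letterRel huv.1 s
    refine ⟨graft u.1 fun s => if s = v.2 then y else d s,
      IsTree.graft huv.1 (fun s => ?_) fun s => ?_, rfl, v.2 :: z, ?_, ?_⟩
    · split_ifs
      exacts [hy, hd s]
    · split_ifs with hs
      · rw [hyv, hs]
        exact huv.2.2.1
      · exact hd' s
    · exact FreeGroup.isReduced_cons_cons.2 ⟨huv.2.2.2, hz⟩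
    · simpa [graft] using hyz

theorem IsTree.rel_toWord [DecidableEq β] {y : List (β × Bool) → α} (hy : IsTree R V y)
    (g : FreeGroup β) (i : β) : R i (y g.toWord) (y (g * FreeGroup.of i).toWord) := by
  by_cases h : ∃ l, g.toWord = l ++ [(i, false)]
  · obtain ⟨l, hl⟩ := h
    have hg : g * FreeGroup.of i = FreeGroup.mk l := by
      rw [← FreeGroup.mk_toWord (x := g), hl, ← FreeGroup.mul_mk, mul_assoc]
      have : FreeGroup.mk [(i, false)] * FreeGroup.of i = 1 := by
        rw [mul_eq_one_iff_eq_inv, FreeGroup.of, FreeGroup.inv_mk]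
        rfl
      rw [this, mul_one]
    have hr : FreeGroup.IsReduced l :=
      isReduced_of_append_append (FreeGroup.isReduced_toWord (x := g))
        [] [(i, false)] (by simp [hl])
    have := hy.2 l (i, false)
    rw [hg, FreeGroup.toWord_mk, hr.reduce_eq, hl]
    simpa [LetterRel] using this
  · have hr : FreeGroup.IsReduced (g.toWord ++ [(i, true)]) := by
      refine List.isChain_append.2 ⟨FreeGroup.isReduced_toWord, List.isChain_singleton _, ?_⟩
      rintro ⟨j, b⟩ hj _ ⟨⟩ rfl
      cases b
      · exact absurd ⟨_, (List.dropLast_append_getLast? _ hj).symm⟩ h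
      · rfl
    have := hy.2 g.toWord (i, true)
    rw [FreeGroup.toWord_mul, FreeGroup.toWord_of, hr.reduce_eq]
    simpa [LetterRel] using this

theorem exists_seq_of_reflTransGen {γ : Type*} {r : γ → γ → Prop} {a b : γ}
    (h : Relation.ReflTransGen r a b) :
    ∃ (f : ℕ → γ) (K : ℕ), f 0 = a ∧ f K = b ∧ ∀ k < K, r (f k) (f (k + 1)) := by
  induction h using Relation.ReflTransGen.head_induction_on with
  | refl => exact ⟨fun _ => b, 0, rfl, rfl, by simp⟩
  | @head a c hac _ ih =>
    obtain ⟨f, K, h0, hK, hf⟩ := ih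
    refine ⟨fun k => Nat.casesOn k a f, K + 1, rfl, hK, ?_⟩
    rintro (_ | k) hk
    · simpa [h0] using hac
    · exact hf k (by lia)

theorem exists_seq_of_loop {γ : Type*} {r : γ → γ → Prop} {u v : γ} (huv : r u v)
    (h : Relation.ReflTransGen r v u) :
    ∃ p : ℕ → γ, (∀ k, r (p k) (p (k + 1))) ∧ ∀ N, ∃ k, N < k ∧ p k = u ∧ p (k + 1) = v := by
  obtain ⟨f, K, h0, hK, hf⟩ := exists_seq_of_reflTransGen h
  refine ⟨fun k => f (k % (K + 1)), fun k => ?_, fun N => ⟨K + (K + 1) * (N + 1), ?_, ?_, ?_⟩⟩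
  · have hlt := Nat.mod_lt k (Nat.succ_pos K)
    by_cases hk : k % (K + 1) = K
    · have : (k + 1) % (K + 1) = 0 := by
        rw [Nat.add_mod, hk]
        rcases K with _ | K
        · simp
        · simp [Nat.mod_eq_of_lt]
      simpa only [this, hk, h0, hK] using huv
    · have hs : k % (K + 1) + 1 < K + 1 := by lia
      have : (k + 1) % (K + 1) = k % (K + 1) + 1 := by
        rw [← Nat.mod_add_mod, Nat.mod_eq_of_lt hs]
      simpa only [this] using hf _ (by lia)
  · nlinarith
  · simp [hK]
  · have : K + (K + 1) * (N + 1) + 1 = (K + 1) * (N + 2) := by ring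
    simp [this, h0]

/-- The labelling of words following the walk `p` along its letters and given by `side` away from
it. -/
def spine [DecidableEq β] (p : ℕ → α × (β × Bool))
    (side : ℕ → β × Bool → List (β × Bool) → α) : ℕ → List (β × Bool) → α
  | k, [] => (p k).1
  | k, s :: l => if s = (p (k + 1)).2 then spine p side (k + 1) l else side k s l

theorem isReduced_range_map_append {p : ℕ → α × (β × Bool)}
    (hp : ∀ k, NodeStep R V (p k) (p (k + 1))) {k : ℕ}
    {z : List (β × Bool)} (hz : FreeGroup.IsReduced ((p k).2 :: z)) :
    FreeGroup.IsReduced ((List.range k).map (fun i => (p (i + 1)).2) ++ z) := by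
  induction k generalizing z with
  | zero => exact isReduced_of_append_append hz [(p 0).2] [] (by simp)
  | succ k ih =>
    rw [List.range_succ, List.map_append, List.append_assoc, List.map_singleton,
      List.singleton_append]
    exact ih (FreeGroup.isReduced_cons_cons.2 ⟨(hp k).2.2.2, hz⟩)

section Spine

variable [DecidableEq β] {p : ℕ → α × (β × Bool)} {side : ℕ → β × Bool → List (β × Bool) → α}

theorem isTree_spine (hp : ∀ k, NodeStep R V (p k) (p (k + 1)))
    (hside : ∀ k s, IsTree R V (side k s))
    (hrel : ∀ k s, LetterRel R s (p k).1 (side k s [])) (k : ℕ) :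
    IsTree R V (spine p side k) := by
  constructor
  · intro l
    induction l generalizing k with
    | nil => exact (hp k).1
    | cons s l ih =>
      rw [spine]
      split_ifs
      exacts [ih _, (hside k s).1 l]
  · intro l s
    induction l generalizing k with
    | nil =>
      rw [List.nil_append, spine, spine]
      split_ifs with hs
      · rw [hs, spine]
        exact (hp k).2.2.1
      · exact hrel k s
    | cons t l ih =>
      rw [List.cons_append, spine, spine]
      split_ifs
      exacts [ih _, (hside k t).2 l s]

theorem spine_append (k : ℕ) (z : List (β × Bool)) :
    spine p side 0 ((List.range k).map (fun i => (p (i + 1)).2) ++ z) = spine p side k z := by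
  induction k generalizing z with
  | zero => rfl
  | succ k ih =>
    rw [List.range_succ, List.map_append, List.append_assoc, ih, List.map_singleton,
      List.singleton_append, spine, if_pos rfl]

theorem spine_eq_graft {k : ℕ} {z : List (β × Bool)} (hz : z.head? ≠ some (p (k + 1)).2) :
    spine p side k z = graft (p k).1 (side k) z := by
  cases z with
  | nil => rfl
  | cons s l =>
    rw [spine, if_neg (by simpa using hz)]
    rfl

end Spine

theorem HasRecurringLoop.exists_configuration (hV : IsExtendable R V)
    (h : HasRecurringLoop R V a₀) :
    ∃ x : FreeGroup β → α, (∀ g, x g ∈ V) ∧ (∀ g i, R i (x g) (x (g * FreeGroup.of i))) ∧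
      {g | x g = a₀}.Infinite := by
  classical
  obtain ⟨u, v, huv, hvu, hb⟩ := h
  obtain ⟨p, hp, hinf⟩ := exists_seq_of_loop huv hvu
  obtain ⟨f, hf, hrel, z, hz, hzv, hfz⟩ : ∃ f : β × Bool → List (β × Bool) → α,
      (∀ s, IsTree R V (f s)) ∧ (∀ s, LetterRel R s u.1 (f s [])) ∧
      ∃ z, FreeGroup.IsReduced (u.2 :: z) ∧ z.head? ≠ some v.2 ∧ graft u.1 f z = a₀ := by
    choose d hd hd' using fun s => hV.exists_isTree_letterRel huv.1 s
    obtain hu | ⟨v', w, huv', hne, hw, hwa⟩ := hb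
    · exact ⟨d, hd, hd', [], FreeGroup.IsReduced.singleton, by simp, hu⟩
    · obtain ⟨y, hy, hyv, z, hz, hyz⟩ := hV.exists_isTree_of_reflTransGen hw huv'.2.1 hwa
      refine ⟨fun s => if s = v'.2 then y else d s, fun s => ?_, fun s => ?_, v'.2 :: z,
        FreeGroup.isReduced_cons_cons.2 ⟨huv'.2.2.2, hz⟩, by simpa using hne, ?_⟩
      · dsimp only
        split_ifs
        exacts [hy, hd s]
      · dsimp only
        split_ifs with hs
        · rw [hyv, hs]
          exact huv'.2.2.1
        · exact hd' s
      · simpa [graft] using hyz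
  choose d hd hd' using fun k s => hV.exists_isTree_letterRel (hp k).1 s
  let side : ℕ → β × Bool → List (β × Bool) → α := fun k => if p k = u then f else d k
  have hside : ∀ k s, IsTree R V (side k s) := by
    intro k s
    by_cases hk : p k = u
    · simpa [side, hk] using hf s
    · simpa [side, hk] using hd k s
  have hsrel : ∀ k s, LetterRel R s (p k).1 (side k s []) := by
    intro k s
    by_cases hk : p k = u
    · simpa [side, hk] using hrel s
    · simpa [side, hk] using hd' k s
  have hy := isTree_spine hp hside hsrel 0
  refine ⟨fun g => spine p side 0 g.toWord, fun g => hy.1 _, fun g i => hy.rel_toWord g i, ?_⟩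
  refine Set.Infinite.of_image (fun g => g.toWord.length)
    (Set.infinite_of_forall_exists_gt fun N => ?_)
  obtain ⟨k, hNk, hku, hkv⟩ := hinf N
  have hred := isReduced_range_map_append hp (k := k) (z := z) (by rwa [hku])
  refine ⟨_, ⟨FreeGroup.mk ((List.range k).map (fun i => (p (i + 1)).2) ++ z), ?_, rfl⟩, ?_⟩
  · change spine p side 0 (FreeGroup.toWord _) = a₀
    rw [FreeGroup.toWord_mk, hred.reduce_eq, spine_append,
      spine_eq_graft (by rwa [hkv])]
    simpa [side, hku] using hfz
  · simp only [FreeGroup.toWord_mk, hred.reduce_eq, List.length_append, List.length_map,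
      List.length_range]
    lia

theorem exists_ray {σ : Type*} [Finite σ] {O : Set (List σ)} (hO : O.Infinite) :
    ∃ s : ℕ → σ, ∀ k, ∃ z, (List.range k).map s ++ z ∈ O := by
  have hstep : ∀ l : {l : List σ // {z | l ++ z ∈ O}.Infinite},
      ∃ s, {z | (l.1 ++ [s]) ++ z ∈ O}.Infinite := by
    rintro ⟨l, hl⟩
    by_contra! h
    refine hl (((Set.finite_singleton ([] : List σ)).union (Set.finite_iUnion fun s =>
      (h s).image (List.cons s))).subset ?_)
    rintro (_ | ⟨s, z⟩) hz
    · exact Or.inl rfl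
    · exact Or.inr (Set.mem_iUnion.2 ⟨s, z, by simpa using hz, rfl⟩)
  choose nxt hnxt using hstep
  let w : ℕ → {l : List σ // {z | l ++ z ∈ O}.Infinite} :=
    fun k => Nat.rec ⟨[], hO⟩ (fun _ l => ⟨l.1 ++ [nxt l], hnxt l⟩) k
  have hw : ∀ k, (List.range k).map (fun i => nxt (w i)) = (w k).1 := by
    intro k
    induction k with
    | zero => rfl
    | succ k ih => rw [List.range_succ, List.map_append, ih]; rfl
  exact ⟨fun i => nxt (w i), fun k => hw k ▸ (w k).2.nonempty⟩

theorem exists_departure {σ : Type*} {O : Set (List σ)} {s : ℕ → σ} {k : ℕ} {z : List σ}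
    (hz : (List.range k).map s ++ z ∈ O) :
    ∃ j, k ≤ j ∧ ∃ z, (List.range j).map s ++ z ∈ O ∧ z.head? ≠ some (s j) := by
  induction z generalizing k with
  | nil => exact ⟨k, le_rfl, [], hz, by simp⟩
  | cons t z ih =>
    by_cases ht : t = s k
    · obtain ⟨j, hj, h⟩ := ih (k := k + 1) (by simpa [List.range_succ, ht] using hz)
      exact ⟨j, by lia, h⟩
    · exact ⟨k, le_rfl, t :: z, hz, by simpa using ht⟩

theorem letterRel_mk {x : FreeGroup β → α} (hx : ∀ g i, R i (x g) (x (g * FreeGroup.of i)))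
    (l : List (β × Bool)) (s : β × Bool) :
    LetterRel R s (x (FreeGroup.mk l)) (x (FreeGroup.mk (l ++ [s]))) := by
  obtain ⟨i, _ | _⟩ := s
  · have : FreeGroup.mk l = FreeGroup.mk (l ++ [(i, false)]) * FreeGroup.of i := by
      rw [← FreeGroup.mul_mk, mul_assoc, left_eq_mul, mul_eq_one_iff_eq_inv, FreeGroup.of,
        FreeGroup.inv_mk]
      rfl
    simpa [LetterRel, ← this] using hx (FreeGroup.mk (l ++ [(i, false)])) i
  · simpa [LetterRel, FreeGroup.of] using hx (FreeGroup.mk l) i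

theorem nodeStep_mk {x : FreeGroup β → α} (hx : ∀ g i, R i (x g) (x (g * FreeGroup.of i)))
    {l : List (β × Bool)} {s t : β × Bool} (h : FreeGroup.IsReduced (l ++ [s] ++ [t])) :
    NodeStep R (Set.range x) (x (FreeGroup.mk (l ++ [s])), s)
      (x (FreeGroup.mk (l ++ [s] ++ [t])), t) :=
  ⟨⟨_, rfl⟩, ⟨_, rfl⟩, letterRel_mk hx _ _,
    (FreeGroup.isReduced_cons_cons.1
      (isReduced_of_append_append (w := [s, t]) h l [] (by simp))).1⟩

theorem exists_reflTransGen_mk {x : FreeGroup β → α}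
    (hx : ∀ g i, R i (x g) (x (g * FreeGroup.of i)))
    {l z : List (β × Bool)} {s : β × Bool} (h : FreeGroup.IsReduced (l ++ [s] ++ z)) :
    ∃ w, Relation.ReflTransGen (NodeStep R (Set.range x)) (x (FreeGroup.mk (l ++ [s])), s) w ∧
      w.1 = x (FreeGroup.mk (l ++ [s] ++ z)) := by
  induction z generalizing l s with
  | nil => exact ⟨_, .refl, by simp⟩
  | cons t z ih =>
    obtain ⟨w, hw, hwx⟩ := ih (l := l ++ [s]) (s := t) (by simpa using h)
    exact ⟨w, .head (nodeStep_mk hx (isReduced_of_append_append h [] z (by simp))) hw,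
      by simpa using hwx⟩

theorem hasRecurringLoop_range [Finite β] {x : FreeGroup β → α} (hfin : (Set.range x).Finite)
    (hx : ∀ g i, R i (x g) (x (g * FreeGroup.of i))) (hinf : {g | x g = a₀}.Infinite) :
    HasRecurringLoop R (Set.range x) a₀ := by
  classical
  let O : Set (List (β × Bool)) := {l | FreeGroup.IsReduced l ∧ x (FreeGroup.mk l) = a₀}
  have hO : O.Infinite := by
    refine (hinf.image (f := FreeGroup.toWord) FreeGroup.toWord_injective.injOn).mono ?_
    rintro _ ⟨g, hg, rfl⟩
    exact ⟨FreeGroup.isReduced_toWord, by rwa [FreeGroup.mk_toWord]⟩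
  obtain ⟨s, hs⟩ := exists_ray hO
  let r : ℕ → List (β × Bool) := fun k => (List.range k).map s
  have hr : ∀ k, r (k + 1) = r k ++ [s k] := fun k => by simp [r, List.range_succ]
  have hred : ∀ k, FreeGroup.IsReduced (r k) := fun k => by
    obtain ⟨z, hz⟩ := hs k
    exact isReduced_of_append_append hz.1 [] z (by simp [r])
  let node : ℕ → α × (β × Bool) := fun k => (x (FreeGroup.mk (r (k + 1))), s k)
  have hnode : ∀ k, NodeStep R (Set.range x) (node k) (node (k + 1)) := by
    intro k
    have := nodeStep_mk hx (l := r k) (s := s k) (t := s (k + 1))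
    rw [← hr, ← hr] at this
    exact this (hred _)
  have hwalk : ∀ i j, i ≤ j →
      Relation.ReflTransGen (NodeStep R (Set.range x)) (node i) (node j) := by
    intro i j hij
    induction j, hij using Nat.le_induction with
    | base => exact .refl
    | succ j _ ih => exact ih.tail (hnode j)
  have hD : {k | ∃ z, r (k + 1) ++ z ∈ O ∧ z.head? ≠ some (s (k + 1))}.Infinite := by
    refine Set.infinite_of_forall_exists_gt fun N => ?_
    obtain ⟨z, hz⟩ := hs (N + 2)
    obtain ⟨j, hj, hz⟩ := exists_departure hz
    obtain ⟨j, rfl⟩ := Nat.exists_eq_add_of_le' (show 1 ≤ j by lia)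
    exact ⟨j, hz, by lia⟩
  obtain ⟨i, ⟨z, hz, hzs⟩, j, -, hij, heq⟩ := hD.exists_lt_map_eq_of_mapsTo (f := node)
    (t := Set.range x ×ˢ Set.univ) (fun k _ => ⟨⟨_, rfl⟩, trivial⟩)
    (hfin.prod Set.finite_univ)
  refine ⟨node i, node (i + 1), hnode i, heq ▸ hwalk (i + 1) j hij, ?_⟩
  cases z with
  | nil => exact Or.inl (by simpa using hz.2)
  | cons t z =>
    have hz1 : FreeGroup.IsReduced (r i ++ [s i] ++ [t] ++ z) := by simpa [hr] using hz.1
    obtain ⟨w, hw, hwx⟩ := exists_reflTransGen_mk hx hz1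
    refine Or.inr ⟨_, w, ?_, ?_, hw, ?_⟩
    · have := nodeStep_mk hx
        (isReduced_of_append_append (w := r i ++ [s i] ++ [t]) hz1 [] z (by simp))
      rwa [← hr] at this ⊢
    · simpa using hzs
    · rw [hwx, ← hz.2, hr, List.append_assoc _ [t], List.singleton_append]

theorem exists_recurring_configuration_iff [Finite β] {U : Set α} (hU : U.Finite) :
    (∃ x : FreeGroup β → α, (∀ g, x g ∈ U) ∧ (∀ g i, R i (x g) (x (g * FreeGroup.of i))) ∧
      {g | x g = a₀}.Infinite) ↔ ∃ V ⊆ U, IsExtendable R V ∧ HasRecurringLoop R V a₀ := by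
  constructor
  · rintro ⟨x, hxU, hx, hinf⟩
    have hsub : Set.range x ⊆ U := Set.range_subset_iff.2 hxU
    refine ⟨Set.range x, hsub, ?_, hasRecurringLoop_range (hU.subset hsub) hx hinf⟩
    rintro _ ⟨g, rfl⟩ s
    obtain ⟨l, rfl⟩ := Quot.exists_rep g
    exact ⟨_, ⟨_, rfl⟩, letterRel_mk hx l s⟩
  · rintro ⟨V, hVU, hV, hloop⟩
    obtain ⟨x, hxV, hx⟩ := hloop.exists_configuration hV
    exact ⟨x, fun g => hVU (hxV g), hx⟩

section Decision

variable {n : ℕ}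

/-- The relation `(a, b, i)` is not forbidden, in terms of codes of forbidden patterns. -/
def CodeRel (L : List ℕ) (i : Fin n) (a b : ℕ) : Prop :=
  Nat.pair a (Nat.pair b i) ∉ L

/-- The letters of the free group on `n` generators. -/
noncomputable def letters (n : ℕ) : List (Fin n × Bool) :=
  Finset.univ.toList

theorem mem_letters (s : Fin n × Bool) : s ∈ letters n := by
  simp [letters]

/-- The nodes with label less than `m`. -/
noncomputable def nodes (n m : ℕ) : List (ℕ × (Fin n × Bool)) :=
  (List.range m).flatMap fun a => (letters n).map fun s => (a, s)

theorem mem_nodes {m : ℕ} {u : ℕ × (Fin n × Bool)} : u ∈ nodes n m ↔ u.1 < m := by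
  obtain ⟨a, s⟩ := u
  simp [nodes, mem_letters]

/-- Reachability along steps, as a quantification over lists of nodes closed under steps. -/
def Reach (m : ℕ) (L V : List ℕ) (u v : ℕ × (Fin n × Bool)) : Prop :=
  ∀ X ∈ (nodes n m).sublists', u ∈ X →
    (∀ p ∈ X, ∀ q ∈ nodes n m, NodeStep (CodeRel L) {a | a ∈ V} p q → q ∈ X) → v ∈ X

theorem reach_iff {m : ℕ} {L V : List ℕ} (hV : ∀ a ∈ V, a < m) {u v : ℕ × (Fin n × Bool)}
    (hu : u.1 < m) :
    Reach m L V u v ↔ Relation.ReflTransGen (NodeStep (CodeRel L) {a | a ∈ V}) u v := by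
  classical
  constructor
  · intro h
    have := h ((nodes n m).filter fun w =>
      Relation.ReflTransGen (NodeStep (CodeRel L) {a | a ∈ V}) u w)
      (List.mem_sublists'.2 List.filter_sublist)
      (List.mem_filter.2 ⟨mem_nodes.2 hu, decide_eq_true .refl⟩) fun p hp q hq hpq =>
        List.mem_filter.2
          ⟨hq, decide_eq_true ((of_decide_eq_true (List.mem_filter.1 hp).2).tail hpq)⟩
    exact of_decide_eq_true (List.mem_filter.1 this).2
  · intro h X _ hu hX
    induction h with
    | refl => exact hu
    | tail _ hpq ih => exact hX _ ih _ (mem_nodes.2 (hV _ hpq.2.1)) hpq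

/-- A bounded formulation of the recurring domino problem for the instance with alphabet size
`d.1`, codes of forbidden patterns `d.2.1` and target letter `d.2.2`. -/
def BoundedCriterion (n : ℕ) (d : ℕ × List ℕ × ℕ) : Prop :=
  ∃ V ∈ (List.range d.1).sublists',
    (∀ a ∈ V, ∀ s ∈ letters n, ∃ b ∈ V, LetterRel (CodeRel d.2.1) s a b) ∧
    ∃ u ∈ nodes n d.1, ∃ v ∈ nodes n d.1, NodeStep (CodeRel d.2.1) {a | a ∈ V} u v ∧
      Reach d.1 d.2.1 V v u ∧
      (u.1 = d.2.2 ∨ ∃ v' ∈ nodes n d.1, ∃ w ∈ nodes n d.1,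
        NodeStep (CodeRel d.2.1) {a | a ∈ V} u v' ∧ v'.2 ≠ v.2 ∧
        Reach d.1 d.2.1 V v' w ∧ w.1 = d.2.2)

theorem boundedCriterion_iff (d : ℕ × List ℕ × ℕ) :
    BoundedCriterion n d ↔ ∃ V ⊆ {a | a < d.1},
      IsExtendable (β := Fin n) (CodeRel d.2.1) V ∧
        HasRecurringLoop (β := Fin n) (CodeRel d.2.1) V d.2.2 := by
  classical
  constructor
  · rintro ⟨V, hV, hext, u, -, v, -, huv, hvu, h⟩
    have hVm : ∀ a ∈ V, a < d.1 := fun a ha =>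
      List.mem_range.1 ((List.mem_sublists'.1 hV).subset ha)
    refine ⟨{a | a ∈ V}, hVm, fun a ha s => hext a ha s (mem_letters s), u, v, huv,
      (reach_iff hVm (hVm _ huv.2.1)).1 hvu, h.imp_right ?_⟩
    rintro ⟨v', -, w, -, huv', hne, hw, hwa⟩
    exact ⟨v', w, huv', hne, (reach_iff hVm (hVm _ huv'.2.1)).1 hw, hwa⟩
  · rintro ⟨V, hVm, hext, hloop⟩
    obtain ⟨l, hl, rfl⟩ : ∃ l ∈ (List.range d.1).sublists', V = {a | a ∈ l} := by
      refine ⟨(List.range d.1).filter (· ∈ V), List.mem_sublists'.2 List.filter_sublist, ?_⟩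
      ext a
      simpa using fun ha => hVm ha
    obtain ⟨u, v, huv, hvu, h⟩ := hloop
    refine ⟨l, hl, fun a ha s _ => hext a ha s, u, mem_nodes.2 (hVm huv.1), v,
      mem_nodes.2 (hVm huv.2.1), huv, (reach_iff (fun _ h => hVm h) (hVm huv.2.1)).2 hvu,
      h.imp_right ?_⟩
    rintro ⟨v', w, huv', hne, hw, hwa⟩
    have hwm : w.1 < d.1 := by
      obtain rfl | ⟨w', -, hw'⟩ := Relation.ReflTransGen.cases_tail hw
      exacts [hVm huv'.2.1, hVm hw'.2.1]
    exact ⟨v', mem_nodes.2 (hVm huv'.2.1), w, mem_nodes.2 hwm, huv', hne,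
      (reach_iff (fun _ h => hVm h) (hVm huv'.2.1)).2 hw, hwa⟩

theorem exists_configuration_iff_boundedCriterion (I : DomInstance n) :
    (∃ x : FreeGroup (Fin n) → Fin I.1,
      (∀ (g : FreeGroup (Fin n)) (i : Fin n), (x g, x (g * FreeGroup.of i), i) ∉ I.2.1) ∧
      {g : FreeGroup (Fin n) | x g = I.2.2}.Infinite) ↔ BoundedCriterion n (rawData I) := by
  obtain ⟨m, F, a₀⟩ := I
  rw [boundedCriterion_iff, ← exists_recurring_configuration_iff (Set.finite_lt_nat _)]
  have hrel (a b : Fin m) (i : Fin n) : CodeRel (codeList F) i a b ↔ (a, b, i) ∉ F :=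
    (encode_mem_codeList (t := (a, b, i))).not
  constructor
  · rintro ⟨x, hx, hinf⟩
    refine ⟨fun g => x g, fun g => (x g).2, fun g i => (hrel _ _ _).2 (hx g i), ?_⟩
    simpa only [rawData, Fin.val_inj] using hinf
  · rintro ⟨x, hxm, hx, hinf⟩
    refine ⟨fun g => ⟨x g, hxm g⟩, fun g i => (hrel _ _ _).1 (hx g i), ?_⟩
    simpa only [rawData, Fin.ext_iff] using hinf

section Primrec

variable {γ : Type*} [Primcodable γ]

theorem primrec_nodes : Primrec (nodes n) :=
  Primrec.list_flatMap Primrec.list_range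
    (Primrec.list_map (Primrec.const _) (Primrec.pair (Primrec.snd.comp Primrec.fst) Primrec.snd))

theorem primrecPred_codeRel {L : γ → List ℕ} {i : γ → Fin n} {a b : γ → ℕ} (hL : Primrec L)
    (hi : Primrec i) (ha : Primrec a) (hb : Primrec b) :
    PrimrecPred fun c => CodeRel (L c) (i c) (a c) (b c) :=
  (PrimrecPred.mem_list (Primrec₂.natPair.comp ha
    (Primrec₂.natPair.comp hb (Primrec.fin_val.comp hi))) hL).not

theorem primrecPred_letterRel {L : γ → List ℕ} {s : γ → Fin n × Bool} {a b : γ → ℕ}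
    (hL : Primrec L) (hs : Primrec s) (ha : Primrec a) (hb : Primrec b) :
    PrimrecPred fun c => LetterRel (CodeRel (L c)) (s c) (a c) (b c) := by
  have hi := Primrec.fst.comp hs
  have ht : PrimrecPred fun c => (s c).2 = true :=
    Primrec.eq.comp (Primrec.snd.comp hs) (Primrec.const true)
  refine ((ht.and (primrecPred_codeRel hL hi ha hb)).or
    (ht.not.and (primrecPred_codeRel hL hi hb ha))).of_eq fun c => ?_
  unfold LetterRel
  split_ifs with h <;> simp [h]

theorem primrecPred_nodeStep {L V : γ → List ℕ} {u v : γ → ℕ × (Fin n × Bool)}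
    (hL : Primrec L) (hV : Primrec V) (hu : Primrec u) (hv : Primrec v) :
    PrimrecPred fun c => NodeStep (CodeRel (L c)) {a | a ∈ V c} (u c) (v c) := by
  have hu1 := Primrec.fst.comp hu
  have hu2 := Primrec.snd.comp hu
  have hv1 := Primrec.fst.comp hv
  have hv2 := Primrec.snd.comp hv
  exact (PrimrecPred.mem_list hu1 hV).and ((PrimrecPred.mem_list hv1 hV).and
    ((primrecPred_letterRel hL hv2 hu1 hv1).and
      (.imp (Primrec.eq.comp (Primrec.fst.comp hu2) (Primrec.fst.comp hv2))
        (Primrec.eq.comp (Primrec.snd.comp hu2) (Primrec.snd.comp hv2)))))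

theorem primrecPred_reach {m : γ → ℕ} {L V : γ → List ℕ} {u v : γ → ℕ × (Fin n × Bool)}
    (hm : Primrec m) (hL : Primrec L) (hV : Primrec V) (hu : Primrec u) (hv : Primrec v) :
    PrimrecPred fun c => Reach (m c) (L c) (V c) (u c) (v c) := by
  have hnodes := (primrec_nodes (n := n)).comp hm
  refine .forall_mem (primrec_sublists'.comp hnodes) (.imp
    (.mem_list (hu.comp Primrec.fst) Primrec.snd) (.imp ?_
      (.mem_list (hv.comp Primrec.fst) Primrec.snd)))
  refine .forall_mem Primrec.snd (.forall_mem (hnodes.comp (Primrec.fst.comp Primrec.fst)) ?_)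
  have hc : Primrec fun c : ((γ × List (ℕ × (Fin n × Bool))) × (ℕ × (Fin n × Bool))) ×
      (ℕ × (Fin n × Bool)) => c.1.1.1 := Primrec.fst.comp (Primrec.fst.comp Primrec.fst)
  exact .imp (primrecPred_nodeStep (hL.comp hc) (hV.comp hc) (Primrec.snd.comp Primrec.fst)
    Primrec.snd) (.mem_list Primrec.snd (Primrec.snd.comp (Primrec.fst.comp Primrec.fst)))

theorem primrecPred_boundedCriterion (n : ℕ) : PrimrecPred (BoundedCriterion n) := by
  have hm : Primrec fun d : ℕ × List ℕ × ℕ => d.1 := Primrec.fst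
  have hL : Primrec fun d : ℕ × List ℕ × ℕ => d.2.1 := Primrec.fst.comp Primrec.snd
  have ha : Primrec fun d : ℕ × List ℕ × ℕ => d.2.2 := Primrec.snd.comp Primrec.snd
  have hnodes := (primrec_nodes (n := n)).comp hm
  refine .exists_mem (primrec_sublists'.comp (Primrec.list_range.comp hm)) (.and ?_ ?_)
  · refine .forall_mem Primrec.snd (.forall_mem (Primrec.const _)
      (.exists_mem (Primrec.snd.comp (Primrec.fst.comp Primrec.fst)) ?_))
    have hc : Primrec fun c : ((((ℕ × List ℕ × ℕ) × List ℕ) × ℕ) × (Fin n × Bool)) × ℕ =>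
      c.1.1 := Primrec.fst.comp Primrec.fst
    exact primrecPred_letterRel (hL.comp (Primrec.fst.comp (Primrec.fst.comp hc)))
      (Primrec.snd.comp Primrec.fst) (Primrec.snd.comp hc) Primrec.snd
  · refine .exists_mem (hnodes.comp Primrec.fst)
      (.exists_mem (hnodes.comp (Primrec.fst.comp Primrec.fst)) ?_)
    have hd := Primrec.fst (α := ℕ × List ℕ × ℕ) (β := List ℕ)
    have hV := Primrec.snd (α := ℕ × List ℕ × ℕ) (β := List ℕ)
    have hc : Primrec fun c : (((ℕ × List ℕ × ℕ) × List ℕ) × (ℕ × (Fin n × Bool))) ×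
      (ℕ × (Fin n × Bool)) => c.1.1 := Primrec.fst.comp Primrec.fst
    have hu := Primrec.snd.comp (Primrec.fst (α := ((ℕ × List ℕ × ℕ) × List ℕ) ×
      (ℕ × (Fin n × Bool))) (β := ℕ × (Fin n × Bool)))
    have hv := Primrec.snd (α := ((ℕ × List ℕ × ℕ) × List ℕ) ×
      (ℕ × (Fin n × Bool))) (β := ℕ × (Fin n × Bool))
    have hdc := hd.comp hc
    refine .and (primrecPred_nodeStep (hL.comp hdc) (hV.comp hc) hu hv)
      (.and (primrecPred_reach (hm.comp hdc) (hL.comp hdc) (hV.comp hc) hv hu)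
        (.or (Primrec.eq.comp (Primrec.fst.comp hu) (ha.comp hdc)) ?_))
    refine .exists_mem (hnodes.comp hdc)
      (.exists_mem (hnodes.comp (hdc.comp Primrec.fst)) ?_)
    have he : Primrec fun c : (((((ℕ × List ℕ × ℕ) × List ℕ) × (ℕ × (Fin n × Bool))) ×
      (ℕ × (Fin n × Bool))) × (ℕ × (Fin n × Bool))) × (ℕ × (Fin n × Bool)) => c.1.1 :=
      Primrec.fst.comp Primrec.fst
    have hv' : Primrec fun c : (((((ℕ × List ℕ × ℕ) × List ℕ) × (ℕ × (Fin n × Bool))) ×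
      (ℕ × (Fin n × Bool))) × (ℕ × (Fin n × Bool))) × (ℕ × (Fin n × Bool)) => c.1.2 :=
      Primrec.snd.comp Primrec.fst
    have hde := hdc.comp he
    have hVe := hV.comp (hc.comp he)
    exact .and (primrecPred_nodeStep (hL.comp hde) hVe (hu.comp he) hv')
      (.and (Primrec.eq.comp (Primrec.snd.comp hv') (Primrec.snd.comp (hv.comp he))).not
        (.and (primrecPred_reach (hm.comp hde) (hL.comp hde) hVe hv' Primrec.snd)
          (Primrec.eq.comp (Primrec.fst.comp Primrec.snd) (ha.comp hde))))

end Primrec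

end Decision

end FreeGroupDomino

/-- The recurring domino problem on the free group `FreeGroup (Fin n)`, with
respect to the free generating family `fun i => FreeGroup.of i`, is decidable. -/
theorem rdp_freeGroup_computablePred (n : ℕ) :
    ComputablePred (fun I : DomInstance n =>
      ∃ x : FreeGroup (Fin n) → Fin I.1,
        (∀ (g : FreeGroup (Fin n)) (i : Fin n),
          (x g, x (g * FreeGroup.of i), i) ∉ I.2.1) ∧
        {g : FreeGroup (Fin n) | x g = I.2.2}.Infinite) := by
  classical
  obtain ⟨_, h⟩ := FreeGroupDomino.primrecPred_boundedCriterion n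
  refine ⟨fun _ => inferInstance, (h.to_comp.comp (computable_rawData n)).of_eq fun I => ?_⟩
  exact decide_eq_decide.2 (FreeGroupDomino.exists_configuration_iff_boundedCriterion I).symm
end

section
/- Let G be a group, H ≤ G a subgroup, m k : ℕ, v : Fin m → Fin k → G a family of literal elements, and ε : Fin m → Fin k → Bool a family of signs. Then the following are equivalent: (1) there exists α : G → Bool such that for every h ∈ H and every i : Fin m there exists j : Fin k with α (h * v i j) = ε i j; (2) there exists x : G → (Fin m → Fin k → Bool) such that for every g ∈ G and every i : Fin m there exists j : Fin k with x g i j = ε i j, and moreover for all g ∈ G and all i, i' : Fin m, j, j' : Fin k, if v i j * (v i' j')⁻¹ ∈ H then x g i j = x (g * (v i j * (v i' j')⁻¹)) i' j'. -/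
/-- The `H`-invariant `k`-SAT formula with literals `v` and signs `ε` is
satisfiable iff the associated nearest-neighbour subshift of finite type over
the alphabet of Boolean `m × k` matrices is nonempty. -/
theorem ksat_satisfiable_iff_sft_nonempty {G : Type*} [Group G]
    (H : Subgroup G) (m k : ℕ) (v : Fin m → Fin k → G)
    (ε : Fin m → Fin k → Bool) :
    (∃ α : G → Bool, ∀ h ∈ H, ∀ i : Fin m, ∃ j : Fin k,
      α (h * v i j) = ε i j) ↔
    (∃ x : G → (Fin m → Fin k → Bool),
      (∀ (g : G) (i : Fin m), ∃ j : Fin k, x g i j = ε i j) ∧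
      (∀ (g : G) (i i' : Fin m) (j j' : Fin k),
        v i j * (v i' j')⁻¹ ∈ H →
          x g i j = x (g * (v i j * (v i' j')⁻¹)) i' j')) := by
  constructor
  · rintro ⟨α, hα⟩
    refine ⟨fun g i j => α ((g : G ⧸ H).out⁻¹ * g * v i j), fun g i => ?_, ?_⟩
    · exact hα _ (QuotientGroup.eq.mp (QuotientGroup.out_eq' (g : G ⧸ H))) i
    · intro g i i' j j' hv
      have hg : ((g * (v i j * (v i' j')⁻¹) : G) : G ⧸ H) = g :=
        QuotientGroup.mk_mul_of_mem g hv
      simp only [hg, mul_assoc, inv_mul_cancel, mul_one]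
  · rintro ⟨x, hx, hxv⟩
    classical
    refine ⟨fun g => decide (∃ h ∈ H, ∃ i j, h * v i j = g ∧ x h i j = true),
      fun h hh i => ?_⟩
    obtain ⟨j, hj⟩ := hx h i
    refine ⟨j, ?_⟩
    rw [← hj, Bool.eq_iff_iff, decide_eq_true_iff]
    refine ⟨?_, fun ht => ⟨h, hh, i, j, rfl, ht⟩⟩
    rintro ⟨h', hh', i', j', heq, ht⟩
    have hv : v i j * (v i' j')⁻¹ = h⁻¹ * h' := by
      rw [mul_inv_eq_iff_eq_mul, mul_assoc, heq, inv_mul_cancel_left]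
    have hcompat := hxv h i i' j j' (hv ▸ H.mul_mem (H.inv_mem hh) hh')
    rwa [hcompat, hv, mul_inv_cancel_left]
end

section
/- Let G be a group and φ : G →* G an injective group homomorphism. Then for every m : ℕ, the range of the m-fold composition φ^m (iterate of φ as an element of Monoid.End G) satisfies (φ^m).range.index = (φ.range.index)^m, where Subgroup.index is Mathlib's index (with value 0 for infinite index). -/
/-- For an injective endomorphism `φ` of a group `G`, the index of the range of
the `m`-fold iterate `φ^m` (iterate as an element of `Monoid.End G`) is the
`m`-th power of the index of the range of `φ`. -/
theorem index_range_pow {G : Type*} [Group G] (φ : G →* G)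
    (hφ : Function.Injective φ) (m : ℕ) :
    (MonoidHom.range ((show Monoid.End G from φ) ^ m : Monoid.End G)).index =
      φ.range.index ^ m := by
  induction m with
  | zero =>
    rw [pow_zero, pow_zero]
    exact (congrArg Subgroup.index
      (MonoidHom.range_eq_top_of_surjective (MonoidHom.id G) Function.surjective_id)).trans
      Subgroup.index_top
  | succ m ih =>
    rw [pow_succ', pow_succ, ← ih, ← Subgroup.index_map_of_injective _ hφ]
    exact congrArg Subgroup.index (MonoidHom.range_comp φ _)
end

section
/- Let G be a group, φ : G →* G an injective group homomorphism with range H = φ.range, and R : Set G a right transversal of H, i.e. Subgroup.IsComplement (H : Set G) R (every g ∈ G factors uniquely as h * r with h ∈ H, r ∈ R). Then for every m ≥ 1, the set R_m = { φ^(m−1) (r_{m−1}) * ⋯ * φ (r_1) * r_0 | r_0, …, r_{m−1} ∈ R } is a right transversal of the subgroup (φ^m).range, i.e. Subgroup.IsComplement ((φ^m).range : Set G) R_m. -/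
open scoped Pointwise in
/-- Right transversals compose: transporting a right transversal `R` of `φ.range` along an
injective `ψ` and multiplying by a right transversal `S` of `ψ.range` gives a right transversal
of `(ψ.comp φ).range`. -/
theorem Subgroup.IsComplement.range_comp {K H G : Type*} [Group K] [Group H] [Group G]
    {φ : K →* H} {ψ : H →* G} (hψ : Function.Injective ψ) {R : Set H} {S : Set G}
    (hR : Subgroup.IsComplement (φ.range : Set H) R)
    (hS : Subgroup.IsComplement (ψ.range : Set G) S) :
    Subgroup.IsComplement ((ψ.comp φ).range : Set G) (ψ '' R * S) := by
  constructor
  · rintro ⟨⟨_, y, rfl⟩, ⟨_, _, ⟨r, hr, rfl⟩, s, hs, rfl⟩⟩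
      ⟨⟨_, y', rfl⟩, ⟨_, _, ⟨r', hr', rfl⟩, s', hs', rfl⟩⟩ h
    have h₁ : ψ (φ y * r) * s = ψ (φ y' * r') * s' := by
      simpa [mul_assoc] using h
    have h₂ := @hS.1 (⟨ψ (φ y * r), _, rfl⟩, ⟨s, hs⟩) (⟨ψ (φ y' * r'), _, rfl⟩, ⟨s', hs'⟩) h₁
    obtain ⟨h₂, h₂'⟩ := Prod.ext_iff.mp h₂
    have h₃ := @hR.1 (⟨φ y, _, rfl⟩, ⟨r, hr⟩) (⟨φ y', _, rfl⟩, ⟨r', hr'⟩) (hψ (congrArg Subtype.val h₂))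
    obtain ⟨h₃, h₃'⟩ := Prod.ext_iff.mp h₃
    have hy : φ y = φ y' := congrArg Subtype.val h₃
    have hr : r = r' := congrArg Subtype.val h₃'
    have hs : s = s' := congrArg Subtype.val h₂'
    simp [hy, hr, hs]
  · intro g
    obtain ⟨⟨⟨_, x, rfl⟩, s, hs⟩, rfl⟩ := hS.2 g
    obtain ⟨⟨⟨_, y, rfl⟩, r, hr⟩, rfl⟩ := hR.2 x
    exact ⟨⟨⟨ψ (φ y), y, rfl⟩, ⟨ψ r * s, Set.mul_mem_mul ⟨r, hr, rfl⟩ hs⟩⟩,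
      by simp [mul_assoc]⟩

open scoped Pointwise in
/-- Splitting off the leading factor of the ordered products `f m (ρ m) * ⋯ * f 0 (ρ 0)`. -/
theorem setOf_prod_reverse_range_succ {α M : Type*} [Monoid M] (f : ℕ → α → M) (R : Set α)
    (m : ℕ) :
    {g : M | ∃ ρ : ℕ → α, (∀ j < m + 1, ρ j ∈ R) ∧
      g = ((List.range (m + 1)).reverse.map fun j => f j (ρ j)).prod} =
    f m '' R * {g : M | ∃ ρ : ℕ → α, (∀ j < m, ρ j ∈ R) ∧
      g = ((List.range m).reverse.map fun j => f j (ρ j)).prod} := by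
  ext g
  constructor
  · rintro ⟨ρ, hρ, rfl⟩
    exact ⟨_, ⟨ρ m, hρ m m.lt_succ_self, rfl⟩, _, ⟨ρ, fun j hj => hρ j (by omega), rfl⟩,
      by simp [List.range_succ]⟩
  · rintro ⟨_, ⟨r, hr, rfl⟩, _, ⟨ρ, hρ, rfl⟩, rfl⟩
    refine ⟨Function.update ρ m r, fun j hj => ?_, ?_⟩
    · rcases Nat.lt_succ_iff_lt_or_eq.mp hj with h | rfl
      · simpa [h.ne] using hρ j h
      · simpa using hr
    · have h : ((List.range m).reverse.map fun j => f j (Function.update ρ m r j)) =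
          (List.range m).reverse.map fun j => f j (ρ j) := by
        refine List.map_congr_left fun j hj => ?_
        have hj : j < m := by simpa using hj
        simp [hj.ne]
      rw [List.range_succ, List.reverse_append, List.reverse_singleton, List.singleton_append,
        List.map_cons, List.prod_cons, h, Function.update_self]

/-- If `R` is a right transversal of the range of an injective endomorphism `φ`
of `G`, then for every `m ≥ 1` the set of ordered products
`φ^(m-1) (r_{m-1}) * ⋯ * φ (r _1) * r_0` with each `r_j ∈ R` is a right
transversal of the range of `φ^m`. -/
theorem isComplement_range_pow {G : Type*} [Group G] (φ : G →* G)
    (hφ : Function.Injective φ) (R : Set G)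
    (hR : Subgroup.IsComplement (φ.range : Set G) R)
    (m : ℕ) (hm : 1 ≤ m) :
    Subgroup.IsComplement
      ((MonoidHom.range ((show Monoid.End G from φ) ^ m : Monoid.End G) : Subgroup G) : Set G)
      {g : G | ∃ ρ : ℕ → G, (∀ j < m, ρ j ∈ R) ∧
        g = (((List.range m).reverse.map
          (fun j => ((show Monoid.End G from φ) ^ j : Monoid.End G) (ρ j))).prod)} := by
  clear hm
  induction m with
  | zero =>
    have h : (((show Monoid.End G from φ) ^ 0 : Monoid.End G) : G →* G).range = ⊤ :=
      MonoidHom.range_eq_top.mpr Function.surjective_id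
    rw [h, Subgroup.coe_top]
    exact Subgroup.isComplement_univ_left.mpr ⟨1, by ext; simp⟩
  | succ m ih =>
    have hinj : Function.Injective ((show Monoid.End G from φ) ^ m : Monoid.End G) := by
      rw [Monoid.End.coe_pow]
      exact hφ.iterate m
    rw [setOf_prod_reverse_range_succ
      (fun j => ((show Monoid.End G from φ) ^ j : Monoid.End G)) R m, pow_succ]
    exact Subgroup.IsComplement.range_comp hinj hR ih
end
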